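/- arXiv:2011.00974 — 2 statements merged into one kernel-verified Lean document; each statement's English description precedes it below -/
import Mathlib

section
/- Let n be a positive natural number with n ≡ 0 (mod 8), and let (r_i)_{i≥1} be nonnegative integers, all but finitely many equal to zero, such that ∑_{i≥1} r_i(2^i − 1) = n − α(n) − 2. Then ∑_{i≥1} r_i ≥ α(n) + 2, and equality holds if and only if the sequence (r_i)_{i≥1} is obtained from the binary digit sequence (ε_i(n))_{i≥1} by two successive single splits (the second split being applied to the result of the first). -/
/-- `alpha n` is the number of 1's in the binary expansion of `n`. -/
def alpha (n : ℕ) : ℕ := (Nat.digits 2 n).sum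

/-- `eps N i` is the coefficient of `2^i` in the binary expansion of `N`. -/
def eps (N i : ℕ) : ℕ := N / 2 ^ i % 2

/-- `IsSingleSplit s s'` means `s'` is obtained from `s` by choosing an index `i ≥ 2`
with `s i ≥ 1`, replacing `s (i-1)` by `s (i-1) + 2` and `s i` by `s i - 1`,
leaving all other entries unchanged. -/
def IsSingleSplit (s s' : ℕ → ℕ) : Prop :=
  ∃ i, 2 ≤ i ∧ 1 ≤ s i ∧ s' (i - 1) = s (i - 1) + 2 ∧ s' i = s i - 1 ∧
    ∀ j, j ≠ i - 1 → j ≠ i → s' j = s j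

lemma alpha_rec (n : ℕ) : alpha n = n % 2 + alpha (n / 2) := by
  unfold alpha
  rcases Nat.eq_zero_or_pos n with h | h
  · subst h; simp
  · rw [Nat.digits_def' (by norm_num) h]; simp

lemma eps_succ (n i : ℕ) : eps n (i + 1) = eps (n / 2) i := by
  unfold eps
  rw [pow_succ', Nat.div_div_eq_div_mul]

lemma binary_range (N : ℕ) : ∀ g : ℕ → ℕ, (∀ i, g i ≤ 1) → (∀ i, N ≤ i → g i = 0) →
    (∀ i, g i = eps (∑ j ∈ Finset.range N, g j * 2 ^ j) i) ∧
    ∑ j ∈ Finset.range N, g j = alpha (∑ j ∈ Finset.range N, g j * 2 ^ j) := by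
  induction N with
  | zero =>
    intro g h1 h2
    refine ⟨fun i => ?_, ?_⟩
    · simp [eps, h2 i (Nat.zero_le i)]
    · simp [alpha]
  | succ N ih =>
    intro g h1 h2
    obtain ⟨ha, hb⟩ := ih (fun i => g (i + 1)) (fun i => h1 _) (fun i hi => h2 _ (by omega))
    have e : ∑ j ∈ Finset.range (N + 1), g j * 2 ^ j
        = 2 * (∑ j ∈ Finset.range N, g (j + 1) * 2 ^ j) + g 0 := by
      rw [Finset.sum_range_succ', Finset.mul_sum]
      simp only [pow_succ, pow_zero, mul_one]
      congr 1
      exact Finset.sum_congr rfl fun j _ => by ring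
    have h0 := h1 0
    rw [e, Finset.sum_range_succ', hb]
    generalize (∑ j ∈ Finset.range N, g (j + 1) * 2 ^ j) = S at *
    have hd : (2 * S + g 0) / 2 = S := by omega
    have hm : (2 * S + g 0) % 2 = g 0 := by omega
    refine ⟨fun i => ?_, ?_⟩
    · cases i with
      | zero => simp [eps, hm]
      | succ i => rw [eps_succ, hd]; exact ha i
    · rw [alpha_rec (2 * S + g 0), hd, hm, add_comm]

/-- total weight -/
noncomputable def wt (f : ℕ →₀ ℕ) : ℕ := f.sum fun i a => a * 2 ^ i
/-- total count -/
noncomputable def sz (f : ℕ →₀ ℕ) : ℕ := f.sum fun _ a => a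

lemma wt_add (f g : ℕ →₀ ℕ) : wt (f + g) = wt f + wt g :=
  Finsupp.sum_add_index' (by simp) (by intros; ring)
lemma sz_add (f g : ℕ →₀ ℕ) : sz (f + g) = sz f + sz g :=
  Finsupp.sum_add_index' (by simp) (by intros; ring)
lemma wt_single (i a : ℕ) : wt (Finsupp.single i a) = a * 2 ^ i := by simp [wt]
lemma sz_single (i a : ℕ) : sz (Finsupp.single i a) = a := by simp [sz]

lemma binary_fs (g : ℕ →₀ ℕ) (h1 : ∀ i, g i ≤ 1) :
    (∀ i, g i = eps (wt g) i) ∧ sz g = alpha (wt g) := by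
  obtain ⟨N, hN⟩ : ∃ N, ∀ i ∈ g.support, i < N :=
    ⟨g.support.sup id + 1, fun i hi => Nat.lt_succ_of_le (Finset.le_sup (f := id) hi)⟩
  have hs : g.support ⊆ Finset.range N := fun i hi => Finset.mem_range.2 (hN i hi)
  have hz : ∀ i, N ≤ i → g i = 0 := by
    intro i hi
    by_contra h
    exact absurd (hN i (Finsupp.mem_support_iff.2 h)) (by omega)
  have h := binary_range N g h1 hz
  have e1 : wt g = ∑ j ∈ Finset.range N, g j * 2 ^ j :=
    Finsupp.sum_of_support_subset _ hs _ (by simp)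
  have e2 : sz g = ∑ j ∈ Finset.range N, g j :=
    Finsupp.sum_of_support_subset _ hs _ (by simp)
  rw [e1, e2]; exact h

lemma merge (f : ℕ →₀ ℕ) (i : ℕ) (h : 2 ≤ f i) :
    ∃ f' : ℕ →₀ ℕ, f + Finsupp.single (i + 1) 1 = f' + Finsupp.single i 2 ∧
      wt f' = wt f ∧ sz f = sz f' + 1 := by
  have e : f + Finsupp.single (i + 1) 1 =
      (f - Finsupp.single i 2 + Finsupp.single (i + 1) 1) + Finsupp.single i 2 := by
    ext j
    simp only [Finsupp.add_apply, Finsupp.tsub_apply, Finsupp.single_apply]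
    split_ifs <;> subst_vars <;> omega
  refine ⟨_, e, ?_, ?_⟩
  · have := congrArg wt e
    rw [wt_add, wt_add _ (Finsupp.single i 2), wt_single, wt_single, pow_succ] at this
    omega
  · have := congrArg sz e
    rw [sz_add, sz_add _ (Finsupp.single i 2), sz_single, sz_single] at this
    omega

lemma exists_bin (k : ℕ) : ∀ f : ℕ →₀ ℕ, sz f = k →
    ∃ g : ℕ →₀ ℕ, (∀ i, g i ≤ 1) ∧ wt g = wt f ∧ sz g ≤ sz f := by
  induction k with
  | zero =>
    intro f hf
    by_cases h : ∀ i, f i ≤ 1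
    · exact ⟨f, h, rfl, le_rfl⟩
    · push Not at h
      obtain ⟨i, hi⟩ := h
      obtain ⟨f', _, h2, h3⟩ := merge f i hi
      omega
  | succ k ih =>
    intro f hf
    by_cases h : ∀ i, f i ≤ 1
    · exact ⟨f, h, rfl, le_rfl⟩
    · push Not at h
      obtain ⟨i, hi⟩ := h
      obtain ⟨f', _, h2, h3⟩ := merge f i hi
      obtain ⟨g, a, b, c⟩ := ih f' (by omega)
      exact ⟨g, a, by omega, by omega⟩

lemma alpha_le (f : ℕ →₀ ℕ) : alpha (wt f) ≤ sz f := by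
  obtain ⟨g, a, b, c⟩ := exists_bin _ f rfl
  have := (binary_fs g a).2
  rw [b] at this
  omega

lemma exists_eps (n : ℕ) : ∃ g : ℕ →₀ ℕ, (∀ i, g i = eps n i) ∧ wt g = n ∧ sz g = alpha n := by
  obtain ⟨g, a, b, c⟩ := exists_bin _ (Finsupp.single 0 n) rfl
  rw [wt_single, pow_zero, mul_one] at b
  have := binary_fs g a
  rw [b] at this
  exact ⟨g, this.1, b, this.2⟩

lemma alpha_add (a b : ℕ) : alpha (a + b) ≤ alpha a + alpha b := by
  obtain ⟨f, _, hf, hf'⟩ := exists_eps a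
  obtain ⟨g, _, hg, hg'⟩ := exists_eps b
  have := alpha_le (f + g)
  rw [wt_add, sz_add] at this
  simp_all

lemma alpha_le_self (a : ℕ) : alpha a ≤ a := by
  have := alpha_le (Finsupp.single 0 a)
  simpa [wt_single, sz_single] using this

lemma alpha_two_mul (a : ℕ) : alpha (2 * a) = alpha a := by
  rw [alpha_rec]; simp

lemma split_iff (f g : ℕ →₀ ℕ) : IsSingleSplit f g ↔
    ∃ i, 1 ≤ i ∧ g + Finsupp.single (i + 1) 1 = f + Finsupp.single i 2 := by
  constructor
  · rintro ⟨i, h2, h1, ha, hb, hc⟩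
    refine ⟨i - 1, by omega, ?_⟩
    rw [Nat.sub_add_cancel (by omega)]
    ext j
    simp only [Finsupp.add_apply, Finsupp.single_apply]
    by_cases e1 : j = i - 1
    · subst e1; rw [if_neg (by omega), if_pos rfl]; omega
    · by_cases e2 : j = i
      · subst e2; rw [if_pos rfl, if_neg (by omega)]; omega
      · rw [if_neg (by omega), if_neg (by omega), hc j e1 e2]
  · rintro ⟨i, h1, h⟩
    have hj : ∀ j, g j + (if i + 1 = j then 1 else 0) = f j + (if i = j then 2 else 0) := by
      intro j
      have := DFunLike.congr_fun h j
      simpa only [Finsupp.add_apply, Finsupp.single_apply] using this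
    have ha := hj i
    have hb := hj (i + 1)
    simp at ha hb
    refine ⟨i + 1, by omega, by omega, by simpa using ha, by omega, ?_⟩
    intro j e1 e2
    have := hj j
    rw [if_neg (by omega), if_neg (by omega)] at this
    simpa using this

lemma split_finsupp (f : ℕ →₀ ℕ) (s : ℕ → ℕ) (h : IsSingleSplit f s) :
    ∃ g : ℕ →₀ ℕ, s = g := by
  obtain ⟨i, h2, h1, ha, hb, hc⟩ := h
  have hfin : (Function.support s).Finite := by
    apply (f.support ∪ {i - 1, i}).finite_toSet.subset
    intro j hj
    simp only [Finset.coe_union, Finset.coe_insert, Finset.coe_singleton, Set.mem_union,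
      Finset.mem_coe, Finsupp.mem_support_iff, Set.mem_insert_iff, Set.mem_singleton_iff]
    by_contra hh
    push Not at hh
    exact hj ((hc j hh.2.1 hh.2.2).trans hh.1)
  exact ⟨Finsupp.ofSupportFinite s hfin, rfl⟩

lemma split_sz (f g : ℕ →₀ ℕ) (h : IsSingleSplit f g) : sz g = sz f + 1 := by
  obtain ⟨i, _, h⟩ := (split_iff f g).1 h
  have := congrArg sz h
  rw [sz_add, sz_add, sz_single, sz_single] at this
  omega

/-- unsplit when the size is larger than minimal -/
lemma unsplit (f : ℕ →₀ ℕ) (h0 : f 0 = 0) (h : alpha (wt f) < sz f) :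
    ∃ f' : ℕ →₀ ℕ, f' 0 = 0 ∧ wt f' = wt f ∧ sz f = sz f' + 1 ∧ IsSingleSplit f' f := by
  have : ¬ ∀ i, f i ≤ 1 := fun h1 => by have := (binary_fs f h1).2; omega
  push Not at this
  obtain ⟨i, hi⟩ := this
  obtain ⟨f', a, b, c⟩ := merge f i hi
  have hi0 : i ≠ 0 := by rintro rfl; omega
  refine ⟨f', ?_, b, c, (split_iff f' f).2 ⟨i, by omega, a⟩⟩
  have := DFunLike.congr_fun a 0
  simp [Finsupp.single_apply, hi0, h0] at this
  exact this.symm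

lemma min_eq (f : ℕ →₀ ℕ) (h : sz f = alpha (wt f)) : (f : ℕ → ℕ) = eps (wt f) := by
  have : ∀ i, f i ≤ 1 := by
    by_contra hh
    push Not at hh
    obtain ⟨i, hi⟩ := hh
    obtain ⟨f', a, b, c⟩ := merge f i hi
    have := alpha_le f'
    rw [b] at this
    omega
  exact funext (binary_fs f this).1

lemma wt_even (f : ℕ →₀ ℕ) (h0 : f 0 = 0) : 2 ∣ wt f := by
  apply Finset.dvd_sum
  intro i hi
  have : i ≠ 0 := by rintro rfl; exact (Finsupp.mem_support_iff.1 hi) h0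
  exact (dvd_pow_self 2 this).mul_left _

theorem stmt1 (n : ℕ) (hn : 0 < n) (h8 : n % 8 = 0)
    (r : ℕ → ℕ) (hr0 : r 0 = 0) (hfin : (Function.support r).Finite)
    (hsum : ∑ᶠ i, r i * (2 ^ i - 1) = n - alpha n - 2) :
    alpha n + 2 ≤ ∑ᶠ i, r i ∧
      ((∑ᶠ i, r i) = alpha n + 2 ↔
        ∃ s : ℕ → ℕ, IsSingleSplit (eps n) s ∧ IsSingleSplit s r) := by
  obtain ⟨f, rfl⟩ : ∃ f : ℕ →₀ ℕ, r = f := ⟨Finsupp.ofSupportFinite r hfin, rfl⟩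
  have hs : ∑ᶠ i, f i = sz f := by
    rw [finsum_eq_sum_of_support_subset (s := f.support) _ (by simp)]; rfl
  have hw : sz f + ∑ᶠ i, f i * (2 ^ i - 1) = wt f := by
    rw [finsum_eq_sum_of_support_subset (s := f.support)]
    · unfold sz wt Finsupp.sum
      rw [← Finset.sum_add_distrib]
      refine Finset.sum_congr rfl fun i _ => ?_
      have : 1 ≤ 2 ^ i := Nat.one_le_two_pow
      obtain ⟨k, hk⟩ := Nat.exists_eq_add_of_le this
      simp only [hk, Nat.add_sub_cancel_left]; ring
    · intro i hi
      simp at hi ⊢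
      exact hi.1
  rw [hs]
  rw [hsum] at hw
  obtain ⟨m, rfl⟩ : ∃ m, n = 2 * (2 * (2 * m)) := ⟨n / 8, by omega⟩
  have ham : alpha (2 * (2 * (2 * m))) = alpha m := by simp only [alpha_two_mul]
  have hml := alpha_le_self m
  have hlow : alpha (2 * (2 * (2 * m))) + 2 ≤ sz f := by
    by_contra hlt
    push Not at hlt
    rw [ham] at hlt hw
    have hE := wt_even f hr0
    obtain ⟨e, he⟩ : ∃ e, sz f + 2 * e = alpha m + 2 := by
      refine ⟨(alpha m + 2 - sz f) / 2, ?_⟩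
      omega
    have hle := alpha_le f
    have h1 : wt f + 2 * e = 2 * (2 * (2 * m)) := by omega
    have h2 := alpha_add (wt f) (2 * e)
    rw [h1, ham, alpha_two_mul] at h2
    have h3 := alpha_le_self e
    have h4 : e = 1 ∨ e = 2 := by omega
    rcases h4 with rfl | rfl
    · have h5 : wt f = 2 * (2 * (2 * (m - 1) + 1) + 1) := by omega
      have h6 : alpha (wt f) = alpha (m - 1) + 2 := by
        rw [h5, alpha_two_mul, alpha_rec,
          show (2 * (2 * (m - 1) + 1) + 1) / 2 = 2 * (m - 1) + 1 by omega, alpha_rec (2 * (m - 1) + 1),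
          show (2 * (m - 1) + 1) / 2 = m - 1 by omega]
        omega
      have h7 := alpha_add (m - 1) 1
      rw [Nat.sub_add_cancel (by omega)] at h7
      have := alpha_le_self 1
      omega
    · have : alpha 2 = 1 := by simp [alpha]
      omega
  refine ⟨hlow, ?_, ?_⟩
  · intro heq
    have hW : wt f = 2 * (2 * (2 * m)) := by omega
    obtain ⟨f', a1, a2, a3, a4⟩ := unsplit f hr0 (by rw [hW]; omega)
    obtain ⟨f'', b1, b2, b3, b4⟩ := unsplit f' a1 (by rw [a2, hW]; omega)
    have hE := min_eq f'' (by rw [b2, a2, hW]; omega)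
    rw [b2, a2, hW] at hE
    exact ⟨f', hE ▸ b4, a4⟩
  · rintro ⟨s, h1, h2⟩
    obtain ⟨g, c1, c2, c3⟩ := exists_eps (2 * (2 * (2 * m)))
    rw [← funext c1] at h1
    obtain ⟨g', rfl⟩ := split_finsupp g s h1
    have := split_sz _ _ h1
    have := split_sz _ _ h2
    omega
end

section
/- Let c₁ be a nonnegative integer and let (b_j)_{j≥2} be integers with b_j ≥ −1 for all j ≥ 2 and all but finitely many b_j equal to zero. If 4c₁ + ∑_{j≥2} 2^j b_j ≤ 0 and 0 ≤ 2c₁ + ∑_{j≥2} (2^j − 1) b_j, then c₁ = 0 and b_j = 0 for all j ≥ 2. -/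
lemma aux (n : ℕ) : ∀ b : ℕ → ℤ, (∀ j, -1 ≤ b j) →
    ∑ j ∈ Finset.range n, 2 ^ j * b j ≤ 0 →
    (∑ j ∈ Finset.range n, 2 ^ j * b j ≤ ∑ j ∈ Finset.range n, b j) ∧
    (∑ j ∈ Finset.range n, 2 ^ j * b j = 0 → ∑ j ∈ Finset.range n, b j ≤ 0 →
      ∀ j < n, b j = 0) := by
  induction n with
  | zero => intro b _ _; simp
  | succ n ih =>
    intro b hb h
    have e : ∑ j ∈ Finset.range (n+1), 2 ^ j * b j
        = 2 * (∑ j ∈ Finset.range n, 2 ^ j * b (j+1)) + b 0 := by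
      rw [Finset.sum_range_succ', Finset.mul_sum]
      simp only [pow_succ, pow_zero, one_mul]
      congr 1
      apply Finset.sum_congr rfl
      intros; ring
    have e2 := Finset.sum_range_succ' b n
    have ih' := ih (fun j => b (j+1)) (fun j => hb _)
    rw [e] at h ⊢
    rw [e2]
    have h0 := hb 0
    generalize ∑ j ∈ Finset.range n, 2 ^ j * b (j+1) = A at *
    generalize ∑ j ∈ Finset.range n, b (j+1) = S at *
    have hA : A ≤ 0 := by omega
    obtain ⟨i1, i2⟩ := ih' hA
    refine ⟨by omega, fun h3 h4 j hj => ?_⟩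
    have hz : b 0 = 0 := by omega
    cases j with
    | zero => exact hz
    | succ j => exact i2 (by omega) (by omega) j (by omega)

theorem stmt5 (c₁ : ℕ) (b : ℕ → ℤ)
    (hb : ∀ j, 2 ≤ j → -1 ≤ b j) (hfin : (Function.support b).Finite)
    (h1 : 4 * (c₁ : ℤ) + ∑ᶠ j ∈ Set.Ici 2, 2 ^ j * b j ≤ 0)
    (h2 : 0 ≤ 2 * (c₁ : ℤ) + ∑ᶠ j ∈ Set.Ici 2, (2 ^ j - 1) * b j) :
    c₁ = 0 ∧ ∀ j, 2 ≤ j → b j = 0 := by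
  obtain ⟨N, hN⟩ := hfin.bddAbove
  have hz : ∀ j, N < j → b j = 0 := by
    intro j hj
    by_contra hne
    exact absurd (hN (Function.mem_support.mpr hne)) (by omega)
  have key : ∀ f : ℕ → ℤ, ∑ᶠ j ∈ Set.Ici 2, f j * b j
      = ∑ j ∈ Finset.range (N+1), f (j+2) * b (j+2) := by
    intro f
    rw [finsum_mem_eq_sum_of_inter_support_eq (t := Finset.Ico 2 (N+1+2))]
    · rw [Finset.sum_Ico_eq_sum_range]
      simp [add_comm]
    · ext j
      simp only [Set.mem_inter_iff, Set.mem_Ici, Function.mem_support, Finset.coe_Ico, Set.mem_Ico]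
      constructor
      · rintro ⟨h, h'⟩
        refine ⟨⟨h, ?_⟩, h'⟩
        by_contra hc
        exact h' (by rw [hz j (by omega), mul_zero])
      · rintro ⟨h, h'⟩
        exact ⟨h.1, h'⟩
  rw [key (fun j => 2 ^ j)] at h1
  rw [key (fun j => 2 ^ j - 1)] at h2
  have e1 : ∑ j ∈ Finset.range (N+1), (2:ℤ) ^ (j+2) * b (j+2)
      = 4 * ∑ j ∈ Finset.range (N+1), 2 ^ j * b (j+2) := by
    rw [Finset.mul_sum]
    apply Finset.sum_congr rfl
    intros; ring
  simp only [sub_mul, one_mul, Finset.sum_sub_distrib] at h1 h2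
  rw [e1] at h1 h2
  have L := aux (N+1) (fun j => b (j+2)) (fun j => hb _ (by omega))
  generalize ∑ j ∈ Finset.range (N+1), 2 ^ j * b (j+2) = A at *
  generalize ∑ j ∈ Finset.range (N+1), b (j+2) = S at *
  obtain ⟨i1, i2⟩ := L (by omega)
  refine ⟨by omega, fun j hj => ?_⟩
  by_cases hjN : N < j
  · exact hz j hjN
  · have := i2 (by omega) (by omega) (j-2) (by omega)
    rwa [Nat.sub_add_cancel hj] at this
end
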